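/- Let p be holomorphic on the open unit disc 𝔻 with Re p(z) > 0 for all z ∈ 𝔻, let F = Log p have Taylor expansion F(z) = a₀ + ∑_{n≥1} a_n zⁿ, and suppose N ≥ 1 and ε > 0 satisfy ∑_{n>N} |a_n|² < ε. Then limsup_{r→1⁻} (1-r)² I_p(r) ≤ 2π e^{-2} ε. -/

import Mathlib

open Filter Set

/-- The integral mean `I_p(r) = ∫₀^{2π} |z p'(z)/p(z)|² dθ`, `z = r e^{iθ}`. -/
noncomputable def Ip (p : ℂ → ℂ) (r : ℝ) : ℝ :=
  ∫ θ in (0:ℝ)..(2 * Real.pi),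
    ‖(↑r * Complex.exp (↑θ * Complex.I)) * deriv p (↑r * Complex.exp (↑θ * Complex.I)) /
      p (↑r * Complex.exp (↑θ * Complex.I))‖ ^ 2

/-- The exponentials `e^{inθ}` are orthogonal on `[0, 2π]`. -/
theorem integral_exp_mul_exp_neg (n m : ℕ) :
    ∫ θ in (0:ℝ)..(2 * Real.pi),
      Complex.exp (θ * Complex.I) ^ n * (starRingEnd ℂ) (Complex.exp (θ * Complex.I) ^ m)
      = if n = m then 2 * Real.pi else 0 := by
  have hexp : ∀ θ : ℝ, Complex.exp (θ * Complex.I) ^ n *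
      (starRingEnd ℂ) (Complex.exp (θ * Complex.I) ^ m)
      = Complex.exp ((((n : ℂ) - m) * Complex.I) * θ) := by
    intro θ
    rw [map_pow, ← Complex.exp_conj, ← Complex.exp_nat_mul, ← Complex.exp_nat_mul,
      ← Complex.exp_add]
    congr 1
    simp
    ring
  simp_rw [hexp]
  split_ifs with h
  · subst h
    simp
  · have hc : ((n : ℂ) - m) * Complex.I ≠ 0 :=
      mul_ne_zero (sub_ne_zero.mpr (by exact_mod_cast h)) Complex.I_ne_zero
    rw [integral_exp_mul_complex hc]
    have : Complex.exp ((((n : ℂ) - m) * Complex.I) * ((2 * Real.pi : ℝ) : ℂ)) = 1 := by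
      rw [Complex.exp_eq_one_iff]
      exact ⟨(n : ℤ) - m, by push_cast; ring⟩
    rw [this]
    simp

/-- **Parseval's identity** for an absolutely convergent one-sided Fourier series. -/
theorem hasSum_sq_norm_of_hasSum_exp {b : ℕ → ℂ} {g : ℝ → ℂ} (hb : Summable fun n => ‖b n‖)
    (hg : ∀ θ : ℝ, HasSum (fun n => b n * Complex.exp (θ * Complex.I) ^ n) (g θ)) :
    Continuous g ∧
      HasSum (fun n => 2 * Real.pi * ‖b n‖ ^ 2) (∫ θ in (0:ℝ)..(2 * Real.pi), ‖g θ‖ ^ 2) := by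
  have hnorm : ∀ n (θ : ℝ), ‖Complex.exp (θ * Complex.I) ^ n‖ = 1 := fun n θ => by
    rw [norm_pow, Complex.norm_exp_ofReal_mul_I, one_pow]
  have hcont : Continuous g := by
    have : g = fun θ : ℝ => ∑' n, b n * Complex.exp (θ * Complex.I) ^ n :=
      funext fun θ => (hg θ).tsum_eq.symm
    rw [this]
    refine continuous_tsum (fun n => by fun_prop) hb fun n θ => ?_
    rw [norm_mul, hnorm, mul_one]
  have hcoeff : ∀ m : ℕ, ∫ θ in (0:ℝ)..(2 * Real.pi),
      g θ * (starRingEnd ℂ) (Complex.exp (θ * Complex.I) ^ m) = 2 * Real.pi * b m := by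
    intro m
    have h := intervalIntegral.hasSum_integral_of_dominated_convergence
      (μ := MeasureTheory.volume) (a := 0) (b := 2 * Real.pi)
      (F := fun n (θ : ℝ) => b n * Complex.exp (θ * Complex.I) ^ n *
        (starRingEnd ℂ) (Complex.exp (θ * Complex.I) ^ m))
      (f := fun θ => g θ * (starRingEnd ℂ) (Complex.exp (θ * Complex.I) ^ m))
      (fun n _ => ‖b n‖)
      (fun n => Continuous.aestronglyMeasurable (by fun_prop))
      (fun n => .of_forall fun θ _ => by
        rw [norm_mul, norm_mul, RCLike.norm_conj, hnorm, hnorm, mul_one, mul_one])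
      (.of_forall fun θ _ => hb) (by simp)
      (.of_forall fun θ _ => (hg θ).mul_right _)
    simp_rw [mul_assoc, intervalIntegral.integral_const_mul, integral_exp_mul_exp_neg] at h
    refine h.unique ?_
    convert! hasSum_ite_eq m (2 * (Real.pi : ℂ) * b m) using 2 with n
    split_ifs with hnm
    · rw [hnm]; push_cast; ring
    · simp
  refine ⟨hcont, ?_⟩
  have h := intervalIntegral.hasSum_integral_of_dominated_convergence
      (μ := MeasureTheory.volume) (a := 0) (b := 2 * Real.pi)
      (F := fun n (θ : ℝ) => g θ * (starRingEnd ℂ) (b n * Complex.exp (θ * Complex.I) ^ n))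
      (f := fun θ => g θ * (starRingEnd ℂ) (g θ))
      (fun n θ => ‖g θ‖ * ‖b n‖)
      (fun n => Continuous.aestronglyMeasurable (by fun_prop))
      (fun n => .of_forall fun θ _ => by
        rw [norm_mul, RCLike.norm_conj, norm_mul, hnorm, mul_one])
      (.of_forall fun θ _ => hb.mul_left _)
      (by
        simp_rw [tsum_mul_left]
        exact Continuous.intervalIntegrable (by fun_prop) _ _)
      (.of_forall fun θ _ => ((Complex.hasSum_conj'.mpr (by simpa using hg θ))).mul_left _)
  have hterm : ∀ n, ∫ θ in (0:ℝ)..(2 * Real.pi),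
      g θ * (starRingEnd ℂ) (b n * Complex.exp (θ * Complex.I) ^ n)
      = ((2 * Real.pi * ‖b n‖ ^ 2 : ℝ) : ℂ) := by
    intro n
    simp_rw [map_mul (starRingEnd ℂ), mul_left_comm (g _), intervalIntegral.integral_const_mul,
      hcoeff]
    rw [mul_left_comm, Complex.conj_mul']
    push_cast
    ring
  simp_rw [hterm, Complex.mul_conj', ← Complex.ofReal_pow, intervalIntegral.integral_ofReal] at h
  exact_mod_cast h

theorem norm_ofReal_mul_exp_mul_I {r : ℝ} (hr : 0 ≤ r) (θ : ℝ) :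
    ‖(r : ℂ) * Complex.exp (θ * Complex.I)‖ = r := by
  rw [norm_mul, Complex.norm_exp_ofReal_mul_I, mul_one, Complex.norm_of_nonneg hr]

theorem ofReal_mul_exp_mul_I_mem_ball {r : ℝ} (hr : 0 ≤ r) (hr1 : r < 1) (θ : ℝ) :
    (r : ℂ) * Complex.exp (θ * Complex.I) ∈ Metric.ball (0:ℂ) 1 := by
  rwa [mem_ball_zero_iff, norm_ofReal_mul_exp_mul_I hr]

/-- **Parseval's identity** for a power series on the circle of radius `r < 1`. -/
theorem hasSum_sq_norm_of_hasSum_pow {c : ℕ → ℂ} {F : ℂ → ℂ}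
    (hc : ∀ z ∈ Metric.ball (0:ℂ) 1, HasSum (fun n => c n * z ^ n) (F z))
    {r : ℝ} (hr : 0 ≤ r) (hr1 : r < 1) :
    Continuous (fun θ : ℝ => F (r * Complex.exp (θ * Complex.I))) ∧
      HasSum (fun n => 2 * Real.pi * (‖c n‖ * r ^ n) ^ 2)
        (∫ θ in (0:ℝ)..(2 * Real.pi), ‖F (r * Complex.exp (θ * Complex.I))‖ ^ 2) := by
  have hnorm : ∀ n, ‖c n * (r : ℂ) ^ n‖ = ‖c n‖ * r ^ n := fun n => by
    rw [norm_mul, norm_pow, Complex.norm_of_nonneg hr]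
  have h := hasSum_sq_norm_of_hasSum_exp (b := fun n => c n * (r : ℂ) ^ n)
    (g := fun θ => F (r * Complex.exp (θ * Complex.I)))
    (hc r (by rwa [mem_ball_zero_iff, Complex.norm_of_nonneg hr])).summable.norm
    (fun θ => by
      simpa only [mul_pow, mul_assoc] using hc _ (ofReal_mul_exp_mul_I_mem_ball hr hr1 θ))
  simpa only [hnorm] using h

/-- A holomorphic function on the unit disc with bounded imaginary part has square summable
Taylor coefficients. -/
theorem summable_sq_norm_of_abs_im_le {a : ℕ → ℂ} {F : ℂ → ℂ} {M : ℝ}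
    (hF : DifferentiableOn ℂ F (Metric.ball (0:ℂ) 1))
    (ha : ∀ z ∈ Metric.ball (0:ℂ) 1, HasSum (fun n => a n * z ^ n) (F z))
    (hM : ∀ z ∈ Metric.ball (0:ℂ) 1, |(F z).im| ≤ M) :
    Summable fun n => ‖a n‖ ^ 2 := by
  have key : ∀ r : ℝ, 0 ≤ r → r < 1 → ∀ s : Finset ℕ,
      ∑ n ∈ s, (‖a n‖ * r ^ n) ^ 2 ≤ (F 0 ^ 2).re + 2 * M ^ 2 := by
    intro r hr hr1 s
    obtain ⟨hcont, hsum⟩ := hasSum_sq_norm_of_hasSum_pow ha hr hr1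
    have hcontre : Continuous fun θ : ℝ => (F (r * Complex.exp (θ * Complex.I)) ^ 2).re :=
      Complex.continuous_re.comp (hcont.pow 2)
    have hmean : ∫ θ in (0:ℝ)..(2 * Real.pi), F (r * Complex.exp (θ * Complex.I)) ^ 2
        = 2 * Real.pi * F 0 ^ 2 := by
      have hd : DiffContOnCl ℂ (fun z => F z ^ 2) (Metric.ball 0 |r|) := by
        refine DifferentiableOn.diffContOnCl ((hF.pow 2).mono ?_)
        refine Metric.closure_ball_subset_closedBall.trans (Metric.closedBall_subset_ball ?_)
        rwa [abs_of_nonneg hr]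
      have h := hd.circleAverage
      rw [Real.circleAverage_def, inv_smul_eq_iff₀ Real.two_pi_pos.ne'] at h
      simpa [circleMap] using h
    have hre : ∫ θ in (0:ℝ)..(2 * Real.pi), (F (r * Complex.exp (θ * Complex.I)) ^ 2).re
        = 2 * Real.pi * (F 0 ^ 2).re := by
      have h := intervalIntegral.intervalIntegral_re (𝕜 := ℂ) (μ := MeasureTheory.volume)
        (Continuous.intervalIntegrable (hcont.pow 2) 0 (2 * Real.pi))
      simp only [RCLike.re_to_complex, Pi.pow_apply] at h
      rw [h, hmean]
      simp
    have hle : ∫ θ in (0:ℝ)..(2 * Real.pi), ‖F (r * Complex.exp (θ * Complex.I))‖ ^ 2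
        ≤ ∫ θ in (0:ℝ)..(2 * Real.pi),
          ((F (r * Complex.exp (θ * Complex.I)) ^ 2).re + 2 * M ^ 2) := by
      refine intervalIntegral.integral_mono_on Real.two_pi_pos.le
        ((hcont.norm.pow 2).intervalIntegrable _ _)
        ((hcontre.add continuous_const).intervalIntegrable _ _) fun θ _ => ?_
      have h := sq_le_sq' (abs_le.mp (hM _ (ofReal_mul_exp_mul_I_mem_ball hr hr1 θ))).1
        (abs_le.mp (hM _ (ofReal_mul_exp_mul_I_mem_ball hr hr1 θ))).2
      rw [Complex.sq_norm, Complex.normSq_apply, pow_two (F _), Complex.mul_re]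
      linarith
    rw [intervalIntegral.integral_add (hcontre.intervalIntegrable _ _)
      (by simp), hre, intervalIntegral.integral_const, smul_eq_mul, sub_zero] at hle
    have hfin := (sum_le_hasSum s (fun n _ => by positivity) hsum).trans hle
    rw [← Finset.mul_sum, ← mul_add] at hfin
    exact le_of_mul_le_mul_left hfin Real.two_pi_pos
  refine summable_of_sum_le (c := (F 0 ^ 2).re + 2 * M ^ 2) (fun n => by positivity) fun s => ?_
  have hlim : Tendsto (fun r : ℝ => ∑ n ∈ s, (‖a n‖ * r ^ n) ^ 2) (nhdsWithin 1 (Iio 1))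
      (nhds (∑ n ∈ s, ‖a n‖ ^ 2)) := by
    have h : Continuous fun r : ℝ => ∑ n ∈ s, (‖a n‖ * r ^ n) ^ 2 := by fun_prop
    simpa using (h.tendsto 1).mono_left nhdsWithin_le_nhds
  refine le_of_tendsto hlim ?_
  filter_upwards [Ioo_mem_nhdsLT (zero_lt_one (α := ℝ))] with r hr
  exact key r hr.1.le hr.2 s

/-- The Euler derivative `z F'(z)` of a power series with bounded coefficients. -/
theorem hasSum_mul_deriv_of_bounded {a : ℕ → ℂ} {F : ℂ → ℂ} {C : ℝ} (hC : ∀ n, ‖a n‖ ≤ C)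
    (ha : ∀ z ∈ Metric.ball (0:ℂ) 1, HasSum (fun n => a n * z ^ n) (F z))
    {z : ℂ} (hz : z ∈ Metric.ball (0:ℂ) 1) :
    HasSum (fun n : ℕ => (n * a n) * z ^ n) (z * deriv F z) := by
  obtain ⟨s, hzs, hs1⟩ := exists_between (mem_ball_zero_iff.mp hz)
  have hs0 : 0 < s := (norm_nonneg z).trans_lt hzs
  have hsub : Metric.ball (0:ℂ) s ⊆ Metric.ball 0 1 := Metric.ball_subset_ball hs1.le
  have hu : Summable fun n : ℕ => C * (n * s ^ (n - 1)) := by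
    refine Summable.mul_left _ ?_
    have h := (summable_pow_mul_geometric_of_norm_lt_one 1
      (r := s) (by rwa [Real.norm_of_nonneg hs0.le])).mul_left s⁻¹
    refine h.congr fun n => ?_
    rcases n with _ | n
    · simp
    · rw [pow_one, pow_succ, Nat.add_sub_cancel]
      field_simp
  have hbound : ∀ (n : ℕ) (y : ℂ), y ∈ Metric.ball (0:ℂ) s →
      ‖a n * (n * y ^ (n - 1))‖ ≤ C * (n * s ^ (n - 1)) := by
    intro n y hy
    rw [norm_mul, norm_mul, norm_pow, Complex.norm_natCast]
    have hys := (mem_ball_zero_iff.mp hy).le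
    gcongr
    · exact (norm_nonneg _).trans (hC n)
    · exact hC n
  have hzs' : z ∈ Metric.ball (0:ℂ) s := mem_ball_zero_iff.mpr hzs
  have hderiv := hasDerivAt_tsum_of_isPreconnected (g := fun n y => a n * y ^ n)
    (g' := fun n y => a n * (n * y ^ (n - 1))) hu Metric.isOpen_ball
    (convex_ball (0:ℂ) s).isPreconnected
    (fun n y _ => (hasDerivAt_pow n y).const_mul (a n)) hbound hzs' (ha z hz).summable hzs'
  have hFd : HasDerivAt F (∑' n : ℕ, a n * (n * z ^ (n - 1))) z := by
    refine hderiv.congr_of_eventuallyEq ?_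
    filter_upwards [Metric.isOpen_ball.mem_nhds hzs'] with y hy
    exact (ha y (hsub hy)).tsum_eq.symm
  rw [hFd.deriv]
  have hsummable : Summable fun n : ℕ => a n * (n * z ^ (n - 1)) :=
    .of_norm_bounded hu fun n => hbound n z hzs'
  convert! hsummable.hasSum.mul_left z using 2 with n
  rcases n with _ | n
  · simp
  · rw [pow_succ, Nat.add_sub_cancel]
    ring

theorem nat_mul_one_sub_mul_pow_le {r : ℝ} (hr : 0 ≤ r) (n : ℕ) :
    n * (1 - r) * r ^ n ≤ Real.exp (-1) := by
  rcases le_or_gt r 1 with hr1 | hr1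
  · have h1 : r ≤ Real.exp (-(1 - r)) := by linarith [Real.add_one_le_exp (-(1 - r))]
    have h2 : r ^ n ≤ Real.exp (-(n * (1 - r))) := by
      refine (pow_le_pow_left₀ hr h1 n).trans_eq ?_
      rw [← Real.exp_nat_mul]
      ring_nf
    have h3 : n * (1 - r) ≤ Real.exp (n * (1 - r) - 1) := by
      linarith [Real.add_one_le_exp (n * (1 - r) - 1)]
    calc n * (1 - r) * r ^ n
        ≤ Real.exp (n * (1 - r) - 1) * Real.exp (-(n * (1 - r))) := by gcongr
      _ = Real.exp (-1) := by rw [← Real.exp_add]; ring_nf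
  · refine le_trans ?_ (Real.exp_pos _).le
    exact mul_nonpos_of_nonpos_of_nonneg
      (mul_nonpos_of_nonneg_of_nonpos n.cast_nonneg (by linarith)) (by positivity)

/-- Tail estimate: if the Taylor coefficients of `F = Log p` satisfy
`∑_{n>N} |a_n|² < ε`, then `limsup_{r→1⁻} (1-r)² I_p(r) ≤ 2π e^{-2} ε`. -/
theorem stmt19 (p : ℂ → ℂ)
    (hp : DifferentiableOn ℂ p (Metric.ball (0:ℂ) 1))
    (hre : ∀ z ∈ Metric.ball (0:ℂ) 1, 0 < (p z).re)
    (a : ℕ → ℂ)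
    (ha : ∀ z ∈ Metric.ball (0:ℂ) 1, HasSum (fun n : ℕ => a n * z ^ n) (Complex.log (p z)))
    (N : ℕ) (hN : 1 ≤ N) (ε : ℝ) (hε : 0 < ε)
    (htail : ∑' n : ℕ, ‖a (n + N + 1)‖ ^ 2 < ε) :
    Filter.limsup (fun r : ℝ => (1 - r) ^ 2 * Ip p r) (nhdsWithin 1 (Set.Iio 1))
      ≤ 2 * Real.pi * Real.exp (-2) * ε := by
  have hlog : DifferentiableOn ℂ (fun z => Complex.log (p z)) (Metric.ball (0:ℂ) 1) :=
    hp.clog fun z hz => .inl (hre z hz)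
  have hsq : Summable fun n => ‖a n‖ ^ 2 := by
    refine summable_sq_norm_of_abs_im_le (M := Real.pi / 2) hlog ha fun z hz => ?_
    rw [Complex.log_im, Complex.abs_arg_le_pi_div_two_iff]
    exact (hre z hz).le
  have hbdd : ∀ n, ‖a n‖ ≤ √(∑' n, ‖a n‖ ^ 2) := fun n =>
    Real.le_sqrt_of_sq_le (hsq.le_tsum n fun _ _ => by positivity)
  have hder : ∀ z ∈ Metric.ball (0:ℂ) 1,
      HasSum (fun n : ℕ => (n * a n) * z ^ n) (z * deriv p z / p z) := by
    intro z hz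
    have h := hasSum_mul_deriv_of_bounded hbdd ha hz
    have hd := ((hp.differentiableAt (Metric.isOpen_ball.mem_nhds hz)).hasDerivAt.clog
      (.inl (hre z hz))).deriv
    rwa [hd, ← mul_div_assoc] at h
  have hIp : ∀ r : ℝ, 0 ≤ r → r < 1 →
      (1 - r) ^ 2 * Ip p r ≤ (1 - r) ^ 2 * (2 * Real.pi *
        ∑ n ∈ Finset.range (N + 1), (n * ‖a n‖) ^ 2) +
        2 * Real.pi * Real.exp (-2) * ∑' n : ℕ, ‖a (n + N + 1)‖ ^ 2 := by
    intro r hr hr1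
    have hsum := (hasSum_sq_norm_of_hasSum_pow hder hr hr1).2.mul_left ((1 - r) ^ 2)
    change HasSum _ ((1 - r) ^ 2 * Ip p r) at hsum
    simp only [norm_mul, Complex.norm_natCast] at hsum
    rw [← hsum.tsum_eq, ← hsum.summable.sum_add_tsum_nat_add (N + 1)]
    have hsq' : Summable fun n : ℕ => ‖a (n + N + 1)‖ ^ 2 :=
      (summable_nat_add_iff (N + 1)).mpr hsq
    refine add_le_add ?_ ?_
    · rw [Finset.mul_sum, Finset.mul_sum]
      refine Finset.sum_le_sum fun n _ => ?_
      have h : n * ‖a n‖ * r ^ n ≤ n * ‖a n‖ :=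
        mul_le_of_le_one_right (by positivity) (pow_le_one₀ hr hr1.le)
      gcongr
    · rw [← tsum_mul_left]
      have hs := (summable_nat_add_iff (N + 1)).mpr hsum.summable
      simp only [← add_assoc] at hs ⊢
      refine hs.tsum_le_tsum (fun n => ?_) (hsq'.mul_left _)
      generalize n + N + 1 = k
      have h1 : 0 ≤ 1 - r := by linarith
      have h : (k * (1 - r) * r ^ k) ^ 2 ≤ Real.exp (-2) := by
        refine (pow_le_pow_left₀ (by positivity) (nat_mul_one_sub_mul_pow_le hr k) 2).trans_eq ?_
        rw [← Real.exp_nat_mul]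
        norm_num
      calc (1 - r) ^ 2 * (2 * Real.pi * (k * ‖a k‖ * r ^ k) ^ 2)
          = 2 * Real.pi * (k * (1 - r) * r ^ k) ^ 2 * ‖a k‖ ^ 2 := by ring
        _ ≤ 2 * Real.pi * Real.exp (-2) * ‖a k‖ ^ 2 := by gcongr
  have hlim : Tendsto (fun r : ℝ => (1 - r) ^ 2 * (2 * Real.pi *
        ∑ n ∈ Finset.range (N + 1), (n * ‖a n‖) ^ 2) +
        2 * Real.pi * Real.exp (-2) * ∑' n : ℕ, ‖a (n + N + 1)‖ ^ 2) (nhdsWithin 1 (Iio 1))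
      (nhds (2 * Real.pi * Real.exp (-2) * ∑' n : ℕ, ‖a (n + N + 1)‖ ^ 2)) := by
    refine (Continuous.tendsto' (by fun_prop) 1 _ ?_).mono_left nhdsWithin_le_nhds
    simp
  have hlt : 2 * Real.pi * Real.exp (-2) * ∑' n : ℕ, ‖a (n + N + 1)‖ ^ 2
      < 2 * Real.pi * Real.exp (-2) * ε := by gcongr
  refine limsup_le_of_le (IsBoundedUnder.isCoboundedUnder_le
    (isBoundedUnder_of_eventually_ge (a := 0) (.of_forall fun r => ?_))) ?_
  · exact mul_nonneg (sq_nonneg _)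
      (intervalIntegral.integral_nonneg Real.two_pi_pos.le fun θ _ => sq_nonneg _)
  · filter_upwards [hlim.eventually_lt_const hlt, Ioo_mem_nhdsLT (zero_lt_one (α := ℝ))]
      with r h hr
    exact (hIp r hr.1.le hr.2).trans h.le
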